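/- arXiv:2407.03095 — 6 statements merged into one kernel-verified Lean document; each statement's English description precedes it below -/
import Mathlib

section
/- Let 𝔤 be a finite-dimensional real Lie algebra and 𝔥 ⊆ 𝔤 a Lie subalgebra. Suppose there exists D ∈ 𝔥 such that ⁅D, H⁆ = 0 for every H ∈ 𝔥 and ⁅D, X⁆ − X ∈ 𝔥 for every X ∈ 𝔤 (i.e., ad_D induces the identity map on the quotient 𝔤/𝔥). Then there exists a linear subspace V ⊆ 𝔤 such that 𝔤 = 𝔥 ⊕ V as vector spaces, ⁅H, v⁆ ∈ V for all H ∈ 𝔥 and v ∈ V, and ⁅v, w⁆ = 0 for all v, w ∈ V. -/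
/-- Let `𝔤` be a finite-dimensional real Lie algebra and `𝔥 ⊆ 𝔤` a Lie
subalgebra. If there is a `D ∈ 𝔥` which centralizes `𝔥` and whose adjoint action induces the
identity on `𝔤/𝔥`, then `𝔥` admits a complementary subspace `V` with `⁅𝔥, V⁆ ⊆ V` and
`⁅V, V⁆ = 0`. -/
theorem exists_abelian_invariant_complement
    {𝔤 : Type*} [LieRing 𝔤] [LieAlgebra ℝ 𝔤] [FiniteDimensional ℝ 𝔤]
    (𝔥 : LieSubalgebra ℝ 𝔤) (D : 𝔤) (hD : D ∈ 𝔥)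
    (h1 : ∀ H ∈ 𝔥, ⁅D, H⁆ = 0)
    (h2 : ∀ X : 𝔤, ⁅D, X⁆ - X ∈ 𝔥) :
    ∃ V : Submodule ℝ 𝔤, IsCompl 𝔥.toSubmodule V ∧
      (∀ H ∈ 𝔥, ∀ v ∈ V, ⁅H, v⁆ ∈ V) ∧
      (∀ v ∈ V, ∀ w ∈ V, ⁅v, w⁆ = 0) := by
  have mem_V (X : 𝔤) : X ∈ LinearMap.ker (LieAlgebra.ad ℝ 𝔤 D - 1) ↔ ⁅D, X⁆ = X := by
    simp [LinearMap.mem_ker, sub_eq_zero]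
  refine ⟨LinearMap.ker (LieAlgebra.ad ℝ 𝔤 D - 1), ⟨?_, ?_⟩, ?_, ?_⟩
  · rw [Submodule.disjoint_def]
    intro X hX hXV
    rw [← (mem_V X).1 hXV]
    exact h1 X hX
  · rw [codisjoint_iff, Submodule.eq_top_iff']
    intro X
    refine Submodule.mem_sup.2 ⟨-(⁅D, X⁆ - X), neg_mem (h2 X), ⁅D, X⁆, ?_, by abel⟩
    rw [mem_V, ← sub_eq_zero, ← lie_sub]
    exact h1 _ (h2 X)
  · intro H hH v hv
    rw [mem_V] at hv ⊢
    rw [leibniz_lie, h1 H hH, hv, zero_lie, zero_add]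
  · intro v hv w hw
    rw [mem_V] at hv hw
    have hu : ⁅D, ⁅v, w⁆⁆ = ⁅v, w⁆ + ⁅v, w⁆ := by rw [leibniz_lie, hv, hw]
    have hmem : ⁅v, w⁆ ∈ 𝔥 := by simpa [hu] using h2 ⁅v, w⁆
    rw [h1 _ hmem] at hu
    rw [← two_smul ℝ] at hu
    exact (smul_eq_zero_iff_right two_ne_zero).1 hu.symm
end

section
/- Let E be a finite-dimensional real inner product space. Let P : E → End(E) be a linear map such that P(X) is skew-adjoint for every X ∈ E (⟨P(X)Y, Z⟩ = −⟨Y, P(X)Z⟩ for all X, Y, Z), and let Q : E × E → E be a bilinear map with Q(X, Y) = −Q(Y, X). Let E₁ ⊆ E be the linear span of the set {Q(X, Y) : X, Y ∈ E}. Assume: (1) P(X)Y = −Q(X, Y) for all X ∈ E and all Y ∈ E₁; (2) Q(X, Y) + P(Y)X − P(X)Y = 0 for all X, Y ∈ E; (3) ⟨P(X)Y, Z⟩ + ⟨P(Y)Z, X⟩ + ⟨P(Z)X, Y⟩ = 0 for all X, Y, Z ∈ E. Then P = 0 and Q = 0. -/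
open scoped RealInnerProductSpace

/-- (Lemma in the proof of the hyperbolic case `a = -2`.) Given a linear map
`P : E → End(E)` with skew-adjoint values and an antisymmetric bilinear map `Q : E × E → E`
on a finite-dimensional real inner product space `E`, satisfying the three identities coming
from the Jacobi identity (with `E₁` the span of the image of `Q`), we have `P = 0` and
`Q = 0`. -/
theorem P_eq_zero_and_Q_eq_zero
    {E : Type*} [NormedAddCommGroup E] [InnerProductSpace ℝ E] [FiniteDimensional ℝ E]
    (P : E →ₗ[ℝ] E →ₗ[ℝ] E)
    (hP : ∀ X Y Z : E, ⟪P X Y, Z⟫ = -⟪Y, P X Z⟫)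
    (Q : E →ₗ[ℝ] E →ₗ[ℝ] E)
    (hQ : ∀ X Y : E, Q X Y = -Q Y X)
    (h1 : ∀ X : E, ∀ Y ∈ Submodule.span ℝ {z : E | ∃ a b : E, Q a b = z},
        P X Y = -Q X Y)
    (h2 : ∀ X Y : E, Q X Y + P Y X - P X Y = 0)
    (h3 : ∀ X Y Z : E, ⟪P X Y, Z⟫ + ⟪P Y Z, X⟫ + ⟪P Z X, Y⟫ = 0) :
    P = 0 ∧ Q = 0 := by
  set E₁ := Submodule.span ℝ {z : E | ∃ a b : E, Q a b = z}
  have Q_mem (X Y : E) : Q X Y ∈ E₁ := Submodule.subset_span ⟨X, Y, rfl⟩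
  have Q_eq (X Y : E) : Q X Y = P X Y - P Y X := by
    rw [← sub_eq_zero, ← h2 X Y]; abel
  -- `P Y X = 2 P X Y` whenever `Y ∈ E₁`
  have P_swap (X : E) {Y : E} (hY : Y ∈ E₁) : P Y X = (2 : ℝ) • P X Y := by
    rw [two_smul, ← sub_eq_iff_eq_add, ← neg_sub, ← Q_eq, h1 X Y hY]
  have P_E₁_E₁ {X Y : E} (hX : X ∈ E₁) (hY : Y ∈ E₁) : P X Y = 0 := by
    have h : P X Y = (4 : ℝ) • P X Y := by
      conv_lhs => rw [P_swap Y hX, P_swap X hY, smul_smul]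
      norm_num
    have h' : (3 : ℝ) • P X Y = 0 := by
      rw [← sub_eq_zero.mpr h.symm]; module
    simpa using h'
  have P_left {Y : E} (hY : Y ∈ E₁) (Z : E) : P Y Z = 0 := by
    have hmem : P Y Z ∈ E₁ := by
      rw [P_swap Z hY, h1 Z Y hY]
      exact E₁.smul_mem _ (E₁.neg_mem (Q_mem Z Y))
    rw [← inner_self_eq_zero (𝕜 := ℝ), hP, P_E₁_E₁ hY hmem, inner_zero_right, neg_zero]
  have P_right (X : E) {Y : E} (hY : Y ∈ E₁) : P X Y = 0 := by
    simpa [P_left hY X] using (P_swap X hY).symm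
  have Q_zero (X Y : E) : Q X Y = 0 := by
    rw [← inner_self_eq_zero (𝕜 := ℝ)]
    nth_rw 1 [Q_eq]
    rw [inner_sub_left, hP, hP, P_right X (Q_mem X Y), P_right Y (Q_mem X Y)]
    simp
  have P_symm (X Y : E) : P X Y = P Y X := by
    rw [← sub_eq_zero, ← Q_eq, Q_zero]
  have P_skew (X Y Z : E) : ⟪P X Y, Z⟫ = -⟪P X Z, Y⟫ := by
    rw [hP, real_inner_comm]
  refine ⟨?_, LinearMap.ext₂ Q_zero⟩
  refine LinearMap.ext₂ fun X Y => ext_inner_right ℝ fun Z => ?_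
  have h : ⟪P X Y, Z⟫ = -⟪P X Y, Z⟫ := by
    conv_lhs => rw [P_symm, P_skew, P_symm, P_skew, neg_neg, P_symm, P_skew]
  simpa using self_eq_neg.mp h
end

section
/- Let E be a real vector space, ω : E × E → ℝ an alternating bilinear form, L : E → E a linear map, and λ ∈ ℝ. Define a bilinear alternating bracket on the vector space V = ℝ × E × ℝ by ⁅(s, X, t), (s', X', t')⁆ = (λ(t s' − t' s) + ω(X, X'), t·L X' − t'·L X, 0). Then this bracket satisfies the Jacobi identity ⁅u, ⁅v, w⁆⁆ + ⁅v, ⁅w, u⁆⁆ + ⁅w, ⁅u, v⁆⁆ = 0 for all u, v, w ∈ V if and only if ω(L X, Y) + ω(X, L Y) = λ·ω(X, Y) for all X, Y ∈ E. -/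
/-- On `V = ℝ × E × ℝ` (encoding `ℝp ⊕ E ⊕ ℝq`), the bracket
`⁅(s,X,t),(s',X',t')⁆ = (λ(ts' − t's) + ω(X,X'), t·LX' − t'·LX, 0)` satisfies the Jacobi
identity if and only if `ω(LX,Y) + ω(X,LY) = λ·ω(X,Y)` for all `X, Y ∈ E`. -/
theorem jacobi_iff_omega_L_compat
    {E : Type*} [AddCommGroup E] [Module ℝ E]
    (ω : E →ₗ[ℝ] E →ₗ[ℝ] ℝ) (hω : ∀ X : E, ω X X = 0)
    (L : E →ₗ[ℝ] E) (lam : ℝ)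
    (bracket : (ℝ × E × ℝ) → (ℝ × E × ℝ) → (ℝ × E × ℝ))
    (hbracket : ∀ u v : ℝ × E × ℝ,
      bracket u v = (lam * (u.2.2 * v.1 - v.2.2 * u.1) + ω u.2.1 v.2.1,
                     u.2.2 • L v.2.1 - v.2.2 • L u.2.1, 0)) :
    (∀ u v w : ℝ × E × ℝ,
        bracket u (bracket v w) + bracket v (bracket w u) + bracket w (bracket u v) = 0)
      ↔ (∀ X Y : E, ω (L X) Y + ω X (L Y) = lam * ω X Y) := by
  have skew : ∀ X Y : E, ω X Y = -ω Y X := fun X Y =>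
    (LinearMap.IsAlt.neg (B := ω) hω Y X).symm
  constructor
  · intro h X Y
    have h1 := congrArg Prod.fst (h (0, 0, 1) (0, X, 0) (0, Y, 0))
    simp [hbracket] at h1
    linarith [skew Y (L X)]
  · rintro h ⟨s₁, X, t₁⟩ ⟨s₂, Y, t₂⟩ ⟨s₃, Z, t₃⟩
    simp only [hbracket, Prod.mk_add_mk, Prod.mk_eq_zero]
    refine ⟨?_, ?_, by simp⟩
    · simp only [map_sub, map_smul, smul_eq_mul]
      linear_combination -t₁ * h Y Z - t₂ * h Z X - t₃ * h X Y
        + t₁ * skew Z (L Y) + t₂ * skew X (L Z) + t₃ * skew Y (L X)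
    · simp only [map_sub, map_smul]
      module
end

section
/- Let V be a finite-dimensional real vector space of dimension at least 2 equipped with a nondegenerate symmetric bilinear form g. For a linear functional ξ ∈ V*, let ξ♯ ∈ V be the unique vector with g(ξ♯, Y) = ξ(Y) for all Y, and define φ_ξ : V → End(V) by φ_ξ(X)Y = ξ(X)Y + ξ(Y)X − g(X, Y)ξ♯. Then the map ξ ↦ φ_ξ is a linear bijection from V* onto the space of all linear maps φ : V → End(V) such that (a) φ(X)Y = φ(Y)X for all X, Y ∈ V, and (b) for every X ∈ V there exists c ∈ ℝ with g(φ(X)Y, Z) + g(Y, φ(X)Z) = 2c·g(Y, Z) for all Y, Z ∈ V. In other words, the first prolongation of the conformal Lie algebra co(V) is isomorphic to V*. -/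
section

variable {V : Type*} [AddCommGroup V] [Module ℝ V] {g : V →ₗ[ℝ] V →ₗ[ℝ] ℝ}

/-- A nondegenerate symmetric bilinear form on a nontrivial space has a non-isotropic vector. -/
theorem exists_apply_self_ne_zero [Nontrivial V] (hsymm : ∀ X Y : V, g X Y = g Y X)
    (hnd : ∀ X : V, (∀ Y : V, g X Y = 0) → X = 0) : ∃ e : V, g e e ≠ 0 := by
  by_contra! h
  obtain ⟨X, hX⟩ := exists_ne (0 : V)
  refine hX (hnd X fun Y ↦ ?_)
  have hXY := h (X + Y)
  simp only [map_add, LinearMap.add_apply] at hXY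
  linarith [h X, h Y, hsymm X Y]

/-- Vectors are determined by their pairings against a nondegenerate form. -/
theorem eq_of_forall_apply_eq (hnd : ∀ X : V, (∀ Y : V, g X Y = 0) → X = 0) {A B : V}
    (h : ∀ Z : V, g A Z = g B Z) : A = B :=
  sub_eq_zero.mp (hnd _ fun Z ↦ by simp [h Z])

/-- The Koszul-type formula: an element of the first prolongation of `co(V)` is determined by its
conformal factor `ξ`. -/
theorem apply_prolongation_eq (hsymm : ∀ X Y : V, g X Y = g Y X) {φ : V →ₗ[ℝ] V →ₗ[ℝ] V}
    {ξ : V → ℝ} (hφ : ∀ X Y : V, φ X Y = φ Y X)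
    (hξ : ∀ X Y Z : V, g (φ X Y) Z + g Y (φ X Z) = 2 * ξ X * g Y Z) (X Y Z : V) :
    g (φ X Y) Z = ξ X * g Y Z + ξ Y * g X Z - ξ Z * g X Y := by
  have h₁ := hξ X Y Z
  have h₂ := hξ Y Z X
  have h₃ := hξ Z X Y
  rw [hsymm Y (φ X Z)] at h₁
  rw [hsymm Z (φ Y X), hφ Y X, hsymm Z X] at h₂
  rw [hsymm X (φ Z Y), hφ Z X, hφ Z Y] at h₃
  linarith

end


/-- Let `V` be a finite-dimensional real vector space of dimension `≥ 2` with
a nondegenerate symmetric bilinear form `g`. For `ξ ∈ V*` let `ξ♯` be the unique vector with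
`g(ξ♯, Y) = ξ(Y)` and let `φ_ξ(X)Y = ξ(X)Y + ξ(Y)X − g(X,Y)ξ♯`. Then `ξ ↦ φ_ξ` is a linear
bijection from `V*` onto the space of linear maps `φ : V → End(V)` with `φ(X)Y = φ(Y)X` and
`φ(X) ∈ co(V)` for all `X` — i.e. the first prolongation of `co(V)` is `V*`. -/
theorem first_prolongation_co_eq_dual
    {V : Type*} [AddCommGroup V] [Module ℝ V] [FiniteDimensional ℝ V]
    (hdim : 2 ≤ Module.finrank ℝ V)
    (g : V →ₗ[ℝ] V →ₗ[ℝ] ℝ)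
    (hsymm : ∀ X Y : V, g X Y = g Y X)
    (hnd : ∀ X : V, (∀ Y : V, g X Y = 0) → X = 0)
    (sharp : Module.Dual ℝ V → V)
    (hsharp : ∀ (ξ : Module.Dual ℝ V) (Y : V), g (sharp ξ) Y = ξ Y)
    (Φ : Module.Dual ℝ V → (V →ₗ[ℝ] V →ₗ[ℝ] V))
    (hΦ : ∀ (ξ : Module.Dual ℝ V) (X Y : V),
      Φ ξ X Y = ξ X • Y + ξ Y • X - g X Y • sharp ξ) :
    (∀ ξ ξ' : Module.Dual ℝ V, Φ (ξ + ξ') = Φ ξ + Φ ξ') ∧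
    (∀ (c : ℝ) (ξ : Module.Dual ℝ V), Φ (c • ξ) = c • Φ ξ) ∧
    Function.Injective Φ ∧
    Set.range Φ = {φ : V →ₗ[ℝ] V →ₗ[ℝ] V |
      (∀ X Y : V, φ X Y = φ Y X) ∧
      (∀ X : V, ∃ c : ℝ, ∀ Y Z : V,
        g (φ X Y) Z + g Y (φ X Z) = 2 * c * g Y Z)} := by
  have : Nontrivial V := Module.nontrivial_of_finrank_pos (R := ℝ) (by omega)
  obtain ⟨e, he⟩ := exists_apply_self_ne_zero hsymm hnd
  have hgΦ (ξ : Module.Dual ℝ V) (X Y Z : V) :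
      g (Φ ξ X Y) Z = ξ X * g Y Z + ξ Y * g X Z - ξ Z * g X Y := by
    simp [hΦ, hsharp, mul_comm]
  refine ⟨fun ξ ξ' ↦ ?_, fun c ξ ↦ ?_, fun ξ ξ' h ↦ ?_, Set.ext fun φ ↦ ⟨?_, ?_⟩⟩
  · ext X Y
    refine eq_of_forall_apply_eq hnd fun Z ↦ ?_
    simp only [LinearMap.add_apply, map_add, hgΦ]
    ring
  · ext X Y
    refine eq_of_forall_apply_eq hnd fun Z ↦ ?_
    simp only [LinearMap.smul_apply, map_smul, smul_eq_mul, hgΦ]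
    ring
  · ext X
    have h₁ := hgΦ ξ X e e
    rw [h, hgΦ] at h₁
    refine mul_right_cancel₀ he ?_
    linarith
  · rintro ⟨ξ, rfl⟩
    refine ⟨fun X Y ↦ ?_, fun X ↦ ⟨ξ X, fun Y Z ↦ ?_⟩⟩
    · rw [hΦ, hΦ, hsymm X Y, add_comm (ξ X • Y)]
    · rw [hsymm Y, hgΦ, hgΦ, hsymm Z Y]
      ring
  · rintro ⟨hφ, hco⟩
    choose c hc using hco
    let ξ : Module.Dual ℝ V := (g e e)⁻¹ • (g e ∘ₗ φ.flip e)
    have hξ (X : V) : ξ X = c X := by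
      have h₁ := hc X e e
      rw [hsymm (φ X e) e] at h₁
      simp only [ξ, LinearMap.smul_apply, LinearMap.comp_apply, LinearMap.flip_apply, smul_eq_mul]
      field_simp
      linarith
    refine ⟨ξ, ?_⟩
    ext X Y
    refine eq_of_forall_apply_eq hnd fun Z ↦ ?_
    rw [hgΦ, apply_prolongation_eq hsymm hφ hc, hξ, hξ, hξ]
end

section
/- Fix n ≥ 1 and let V = ℝ × ℝⁿ × ℝ with the Minkowski bilinear form η((s, X, t), (s', X', t')) = s·t' + t·s' + ⟨X, X'⟩, and set p = (1, 0, 0). For a, b ∈ V define a∧b ∈ End(V) by (a∧b)w = η(a, w)b − η(b, w)a. For a self-adjoint endomorphism S of ℝⁿ define R_S : V × V → End(V) by R_S((s, X, t), (s', X', t')) = p ∧ (0, t'·S X − t·S X', 0). Let T be a self-adjoint endomorphism of ℝⁿ and T₀ = T − (tr T/n)·id, and assume T₀ ≠ 0. If A is a linear automorphism of V such that η(Av, Aw) = μ·η(v, w) for all v, w ∈ V for some μ > 0, and A ∘ R_{T₀}(A⁻¹Y, A⁻¹Y') ∘ A⁻¹ = R_{T₀}(Y, Y') for all Y, Y' ∈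 V, then also A ∘ R_T(A⁻¹Y, A⁻¹Y') ∘ A⁻¹ = R_T(Y, Y') for all Y, Y' ∈ V. -/
open Matrix

/-- A self-adjoint endomorphism of `ℝⁿ` whose square is traceless vanishes. -/
lemma eq_zero_of_selfAdjoint_of_trace_sq_eq_zero {n : ℕ} {S : (Fin n → ℝ) →ₗ[ℝ] (Fin n → ℝ)}
    (hS : ∀ x y, S x ⬝ᵥ y = x ⬝ᵥ S y)
    (htr : LinearMap.trace ℝ (Fin n → ℝ) (S ∘ₗ S) = 0) : S = 0 := by
  have hM : (LinearMap.toMatrix' S)ᴴ = LinearMap.toMatrix' S := by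
    ext i j
    have := hS (Pi.single i 1) (Pi.single j 1)
    simpa [LinearMap.toMatrix'_apply, conjTranspose_apply] using this
  have h : ((LinearMap.toMatrix' S)ᴴ * LinearMap.toMatrix' S).trace = 0 := by
    rw [hM, ← LinearMap.toMatrix'_comp, ← LinearMap.toMatrix_eq_toMatrix',
      ← LinearMap.trace_eq_matrix_trace, htr]
  rw [trace_conjTranspose_mul_self_eq_zero_iff] at h
  exact LinearMap.toMatrix'.map_eq_zero_iff.mp h

/-- If an injective endomorphism intertwines a nonzero self-adjoint endomorphism of `ℝⁿ` with a
nonnegative multiple of itself, the factor is `1`. -/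
lemma eq_one_of_intertwines_smul {n : ℕ} {S B : (Fin n → ℝ) →ₗ[ℝ] (Fin n → ℝ)}
    (hS : ∀ x y, S x ⬝ᵥ y = x ⬝ᵥ S y) (hS0 : S ≠ 0) (hB : Function.Injective B)
    {c : ℝ} (hc : 0 ≤ c) (h : ∀ x, B (S x) = c • S (B x)) : c = 1 := by
  set e := LinearEquiv.ofInjectiveEndo B hB with he
  have he' : ∀ x, e x = B x := fun x => by simp [he]
  have hconj : e.conj (S ∘ₗ S) = c ^ 2 • (S ∘ₗ S) := by
    refine LinearMap.ext fun x => ?_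
    obtain ⟨y, rfl⟩ := e.surjective x
    rw [LinearEquiv.conj_apply_apply, e.symm_apply_apply]
    simp [he', h, smul_smul, sq]
  have htr := LinearMap.trace_conj' (S ∘ₗ S) e
  rw [hconj, map_smul, smul_eq_mul] at htr
  have hne : LinearMap.trace ℝ (Fin n → ℝ) (S ∘ₗ S) ≠ 0 :=
    fun h0 => hS0 (eq_zero_of_selfAdjoint_of_trace_sq_eq_zero hS h0)
  have hc2 : c ^ 2 = 1 := mul_right_cancel₀ hne (by rw [htr, one_mul])
  nlinarith

/-- Let `V = ℝ^{1,n+1}` with the Minkowski form `η`, and let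
`R_S(v,v') = p ∧ (0, t'·S X − t·S X', 0)` be the algebraic curvature operator of a plane wave
with self-adjoint profile `S`. If `T₀ = T − (tr T/n)·id ≠ 0` is the trace-free (Weyl) part of a
self-adjoint profile `T`, then any linear conformal transformation `A` of `V` preserving
`R_{T₀}` also preserves `R_T`. -/
theorem conformal_preserving_weyl_preserves_curvature
    (n : ℕ) (hn : 1 ≤ n)
    (η : (ℝ × (Fin n → ℝ) × ℝ) → (ℝ × (Fin n → ℝ) × ℝ) → ℝ)
    (hη : ∀ v w : ℝ × (Fin n → ℝ) × ℝ,
      η v w = v.1 * w.2.2 + v.2.2 * w.1 + v.2.1 ⬝ᵥ w.2.1)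
    (wedge : (ℝ × (Fin n → ℝ) × ℝ) → (ℝ × (Fin n → ℝ) × ℝ) →
      (ℝ × (Fin n → ℝ) × ℝ) → (ℝ × (Fin n → ℝ) × ℝ))
    (hwedge : ∀ a b w : ℝ × (Fin n → ℝ) × ℝ, wedge a b w = η a w • b - η b w • a)
    (R : ((Fin n → ℝ) →ₗ[ℝ] (Fin n → ℝ)) → (ℝ × (Fin n → ℝ) × ℝ) →
      (ℝ × (Fin n → ℝ) × ℝ) → (ℝ × (Fin n → ℝ) × ℝ) → (ℝ × (Fin n → ℝ) × ℝ))
    (hR : ∀ (S : (Fin n → ℝ) →ₗ[ℝ] (Fin n → ℝ)) (v v' w : ℝ × (Fin n → ℝ) × ℝ),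
      R S v v' w = wedge (1, 0, 0) (0, v'.2.2 • S v.2.1 - v.2.2 • S v'.2.1, 0) w)
    (T : (Fin n → ℝ) →ₗ[ℝ] (Fin n → ℝ))
    (hT : ∀ x y : Fin n → ℝ, T x ⬝ᵥ y = x ⬝ᵥ T y)
    (T₀ : (Fin n → ℝ) →ₗ[ℝ] (Fin n → ℝ))
    (hT₀ : T₀ = T - ((LinearMap.trace ℝ (Fin n → ℝ) T) / (n : ℝ)) • LinearMap.id)
    (hT₀ne : T₀ ≠ 0)
    (A : (ℝ × (Fin n → ℝ) × ℝ) ≃ₗ[ℝ] (ℝ × (Fin n → ℝ) × ℝ))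
    (μ : ℝ) (hμ : 0 < μ)
    (hconf : ∀ v w : ℝ × (Fin n → ℝ) × ℝ, η (A v) (A w) = μ * η v w)
    (hWeyl : ∀ Y Y' z : ℝ × (Fin n → ℝ) × ℝ,
      A (R T₀ (A.symm Y) (A.symm Y') (A.symm z)) = R T₀ Y Y' z) :
    ∀ Y Y' z : ℝ × (Fin n → ℝ) × ℝ,
      A (R T (A.symm Y) (A.symm Y') (A.symm z)) = R T Y Y' z := by
  have hRS : ∀ (S : (Fin n → ℝ) →ₗ[ℝ] (Fin n → ℝ)) (s s' r : ℝ) (X X' Z : Fin n → ℝ)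
      (t t' k : ℝ), R S (s, X, t) (s', X', t') (r, Z, k) =
        (-((t' • S X - t • S X') ⬝ᵥ Z), k • (t' • S X - t • S X'), 0) := by
    intro S s s' r X X' Z t t' k
    rw [hR, hwedge, hη, hη]
    simp
  have hW : ∀ v v' w, A (R T₀ v v' w) = R T₀ (A v) (A v') (A w) := fun v v' w => by
    simpa using hWeyl (A v) (A v') (A w)
  have hT₀s : ∀ x y, T₀ x ⬝ᵥ y = x ⬝ᵥ T₀ y := fun x y => by
    simp [hT₀, sub_dotProduct, dotProduct_sub, hT]
  -- `A` fixes the null line spanned by `p`.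
  obtain ⟨l, hl⟩ : ∃ l : ℝ, A (1, 0, 0) = (l, 0, 0) := by
    obtain ⟨X, hX⟩ : ∃ X, T₀ X ≠ 0 := by
      by_contra! h
      exact hT₀ne (LinearMap.ext h)
    have hd : T₀ X ⬝ᵥ T₀ X ≠ 0 := fun h => hX (dotProduct_self_eq_zero.mp h)
    have h1 : (-(T₀ X ⬝ᵥ T₀ X)) • A (1, 0, 0) =
        R T₀ (A (0, X, 0)) (A (0, 0, 1)) (A (0, T₀ X, 0)) := by
      rw [← hW, ← map_smul, hRS]
      simp
    have ht : (A (1, 0, 0)).2.2 = 0 := by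
      have h2 := congrArg (fun v => v.2.2) h1
      have h3 : ∀ v v' w, (R T₀ v v' w).2.2 = 0 := fun ⟨_, _, _⟩ ⟨_, _, _⟩ ⟨_, _, _⟩ => by
        rw [hRS]
      rw [h3] at h2
      simpa [hX] using h2
    have hx : (A (1, 0, 0)).2.1 = 0 := by
      have h2 := hconf (1, 0, 0) (1, 0, 0)
      rw [hη, hη, ht] at h2
      exact dotProduct_self_eq_zero.mp (by simpa using h2)
    exact ⟨_, Prod.ext rfl (Prod.ext hx ht)⟩
  obtain ⟨⟨g, Z, κ⟩, hq⟩ : ∃ q, A (0, 0, 1) = q := ⟨_, rfl⟩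
  have hlk : l * κ = μ := by
    have h := hconf (1, 0, 0) (0, 0, 1)
    rw [hl, hq, hη, hη] at h
    simpa using h
  have hl0 : l ≠ 0 := by
    rintro rfl
    simp at hlk
    exact hμ.ne hlk
  set ι : (Fin n → ℝ) →ₗ[ℝ] (ℝ × (Fin n → ℝ) × ℝ) :=
    LinearMap.inr ℝ ℝ _ ∘ₗ LinearMap.inl ℝ (Fin n → ℝ) ℝ
  set f : (Fin n → ℝ) →ₗ[ℝ] ℝ := LinearMap.fst ℝ ℝ _ ∘ₗ A.toLinearMap ∘ₗ ι
  set B : (Fin n → ℝ) →ₗ[ℝ] (Fin n → ℝ) :=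
    LinearMap.fst ℝ _ ℝ ∘ₗ LinearMap.snd ℝ ℝ _ ∘ₗ A.toLinearMap ∘ₗ ι
  have hAX : ∀ X, A (0, X, 0) = (f X, B X, 0) := by
    intro X
    refine Prod.ext rfl (Prod.ext rfl ?_)
    have h := hconf (1, 0, 0) (0, X, 0)
    rw [hl, hη, hη] at h
    simpa [hl0] using h
  have hA : ∀ s X t, A (s, X, t) = (s * l + f X + t * g, B X + t • Z, t * κ) := by
    intro s X t
    have h : ((s, X, t) : ℝ × (Fin n → ℝ) × ℝ) =
        s • (1, 0, 0) + (0, X, 0) + t • (0, 0, 1) := by simp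
    rw [h, map_add, map_add, map_smul, map_smul, hl, hAX, hq]
    simp
  have hBB : ∀ X Y, B X ⬝ᵥ B Y = μ * (X ⬝ᵥ Y) := by
    intro X Y
    have h := hconf (0, X, 0) (0, Y, 0)
    rw [hAX, hAX, hη, hη] at h
    simpa using h
  have hfZ : ∀ X, f X * κ + B X ⬝ᵥ Z = 0 := by
    intro X
    have h := hconf (0, X, 0) (0, 0, 1)
    rw [hAX, hq, hη, hη] at h
    simpa using h
  have hBinj : Function.Injective B := by
    rw [injective_iff_map_eq_zero]
    intro X hX
    have h := hBB X X
    rw [hX, zero_dotProduct, eq_comm, mul_eq_zero] at h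
    exact dotProduct_self_eq_zero.mp (h.resolve_left hμ.ne')
  have hBT₀ : ∀ X, B (T₀ X) = κ ^ 2 • T₀ (B X) := by
    intro X
    have h := congrArg (fun v => v.2.1) (hW (0, X, 0) (0, 0, 1) (0, 0, 1))
    rw [hRS, hAX, hq, hRS, hA] at h
    simpa [smul_smul, sq] using h
  have hκ : κ ^ 2 = 1 := eq_one_of_intertwines_smul hT₀s hT₀ne hBinj (sq_nonneg κ) hBT₀
  have hBT : ∀ X, T (B X) = B (T X) := by
    intro X
    have h := hBT₀ X
    rw [hκ, one_smul, hT₀] at h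
    simpa using h.symm
  have hmain : ∀ v v' w, A (R T v v' w) = R T (A v) (A v') (A w) := by
    rintro ⟨s, X, t⟩ ⟨s', X', t'⟩ ⟨r, Y, k⟩
    have hWB : (t' * κ) • T (B X + t • Z) - (t * κ) • T (B X' + t' • Z) =
        κ • B (t' • T X - t • T X') := by
      simp only [map_add, map_smul, map_sub, hBT]
      module
    rw [hRS, hA, hA, hA, hA, hRS, hWB]
    generalize t' • T X - t • T X' = W
    refine Prod.ext ?_ (Prod.ext ?_ ?_)
    · simp only [map_smul, smul_eq_mul, smul_dotProduct, dotProduct_add, dotProduct_smul, hBB]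
      linear_combination (l * (W ⬝ᵥ Y) - k * f W) * hκ - κ * (W ⬝ᵥ Y) * hlk + k * κ * hfZ W
    · simp only [map_smul, zero_smul, add_zero, smul_smul]
      rw [show k * κ * κ = k * κ ^ 2 by ring, hκ, mul_one]
    · simp
  intro Y Y' z
  simpa using hmain (A.symm Y) (A.symm Y') (A.symm z)
end

section
/- Let G be a group acting on a nonempty set M, let F be a normal subgroup of G that acts transitively on M, and let φ : G → (M → ℝ) be a map satisfying the cocycle identity φ_{ab}(x) = φ_a(b·x) + φ_b(x) for all a, b ∈ G and x ∈ M. If φ_f = 0 for every f ∈ F, then for every a ∈ G the function φ_a : M → ℝ is constant. -/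
/-- (Algebraic content of Lemma on transitive normal isometry subgroups.)
Let `G` act on a nonempty set `M`, let `F` be a normal subgroup of `G` acting transitively
on `M`, and let `φ : G → (M → ℝ)` satisfy the cocycle identity
`φ_{ab}(x) = φ_a(b·x) + φ_b(x)`. If `φ_f = 0` for all `f ∈ F`, then each `φ_a` is constant. -/
theorem cocycle_constant_of_normal_transitive
    {G M : Type*} [Group G] [MulAction G M] [Nonempty M]
    (F : Subgroup G) (hFnormal : F.Normal)
    (hFtrans : ∀ x y : M, ∃ f ∈ F, f • x = y)
    (φ : G → M → ℝ)
    (hcocycle : ∀ (a b : G) (x : M), φ (a * b) x = φ a (b • x) + φ b x)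
    (hF : ∀ f ∈ F, φ f = 0) :
    ∀ (a : G) (x y : M), φ a x = φ a y := by
  intro a x y
  obtain ⟨f, hf, rfl⟩ := hFtrans x y
  have hright := hcocycle a f x
  have hleft := hcocycle (a * f * a⁻¹) a x
  rw [inv_mul_cancel_right, hF _ (hFnormal.conj_mem f hf a)] at hleft
  rw [hF f hf] at hright
  simpa using hleft.symm.trans hright
end
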